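/- arXiv:1408.4263 — 9 statements merged into one kernel-verified Lean document; each statement's English description precedes it below -/
import Mathlib

section
/- Let P be a finite nonempty poset and let φ be a quantified conjunctive sentence in alternating prefix form that is in reduced form. If there exists an element p of P such that m ≤ p ≤ M for every minimal element m of P and every maximal element M of P, then φ is true in P (Eloise has a winning strategy in the Hintikka game on P and φ). -/
/- A quantified conjunctive sentence in alternating prefix form
`∀x_1∃y_1⋯∀x_l∃y_l C` over the vocabulary `{≤}` is represented by its length `l` and its
matrix `M`, a binary relation on the variable set `Fin l ⊕ Fin l`, where `Sum.inl i` is the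
universal variable `x_{i+1}` and `Sum.inr i` is the existential variable `y_{i+1}`;
`M u v` holds iff the atom `u ≤ v` occurs in `C`.  In the prefix order, `x_{i+1}` has
position `2i` and `y_{i+1}` has position `2i+1`. -/

/-- A strategy for Eloise: `g i` chooses the value of `y_{i+1}` from the values of
`x_1, …, x_{i+1}`. -/
def Strategy (α : Type*) (l : ℕ) := (i : Fin l) → (Fin (i.1 + 1) → α) → α

/-- The restriction of a play `f` by Abelard to the universal variables `x_1, …, x_{i+1}`. -/
def trunc {α : Type*} {l : ℕ} (f : Fin l → α) (i : Fin l) : Fin (i.1 + 1) → α :=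
  fun j => f ⟨j.1, by have h1 := j.isLt; have h2 := i.isLt; omega⟩

/-- The assignment of the variables induced by an Abelard play `f` and an Eloise
strategy `g`: `x_{i+1} ↦ f i` and `y_{i+1} ↦ g i (f x_1, …, f x_{i+1})`. -/
def induced {α : Type*} {l : ℕ} (g : Strategy α l) (f : Fin l → α) :
    Fin l ⊕ Fin l → α
  | Sum.inl i => f i
  | Sum.inr i => g i (trunc f i)

/-- The strategy `g` beats the play `f`: the induced assignment satisfies all atoms of the
matrix `M` in the poset. -/
def Beats {α : Type*} [PartialOrder α] {l : ℕ}
    (M : (Fin l ⊕ Fin l) → (Fin l ⊕ Fin l) → Prop)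
    (g : Strategy α l) (f : Fin l → α) : Prop :=
  ∀ u v, M u v → induced g f u ≤ induced g f v

/-- In a finite poset every element has a maximal element above it, chosen by a function. -/
theorem exists_isMax_above (α : Type*) [PartialOrder α] [Finite α] :
    ∃ up : α → α, ∀ a, a ≤ up a ∧ IsMax (up a) := by
  choose up hup using fun a : α => (Set.toFinite (Set.univ : Set α)).exists_le_maximal
    (Set.mem_univ a)
  exact ⟨up, fun a => ⟨(hup a).1, fun b hb => (hup a).2.2 (Set.mem_univ b) hb⟩⟩

/-- In a finite poset every element has a minimal element below it, chosen by a function. -/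
theorem exists_isMin_below (α : Type*) [PartialOrder α] [Finite α] :
    ∃ down : α → α, ∀ a, down a ≤ a ∧ IsMin (down a) :=
  exists_isMax_above αᵒᵈ

open Classical in
/-- Eloise plays `up` of the universal variable below `y`, or `down` of the universal variable
above `y`, or the default `p` if `y` is comparable to no universal variable. -/
noncomputable def extremalStrategy {α : Type*} {l : ℕ}
    (M : (Fin l ⊕ Fin l) → (Fin l ⊕ Fin l) → Prop)
    (hafter : ∀ i j : Fin l,
      (M (Sum.inl j) (Sum.inr i) ∨ M (Sum.inr i) (Sum.inl j)) → j.1 ≤ i.1)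
    (up down : α → α) (p : α) : Strategy α l := fun i t =>
  if h : ∃ j, M (Sum.inl j) (Sum.inr i) then
    up (t ⟨h.choose.1, Nat.lt_succ_of_le (hafter i _ (Or.inl h.choose_spec))⟩)
  else if h : ∃ j, M (Sum.inr i) (Sum.inl j) then
    down (t ⟨h.choose.1, Nat.lt_succ_of_le (hafter i _ (Or.inr h.choose_spec))⟩)
  else p

/-- Let `P` be a finite nonempty poset and `φ` a quantified conjunctive
sentence in alternating prefix form that is in reduced form, i.e. (i) its matrix `M` is a
partial order on the variables, (ii) the universal variables form an antichain in `M`,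
(iii) distinct universal variables have disjoint `M`-upsets and disjoint `M`-downsets,
and (iv) every existential variable `M`-comparable to a universal variable `x_j` occurs
after `x_j` in the prefix.  If some `p ∈ P` satisfies `m ≤ p ≤ q` for every minimal `m`
and maximal `q`, then `φ` is true in `P` (Eloise has a winning strategy). -/
theorem stmt_1 {α : Type*} [PartialOrder α] [Fintype α] [Nonempty α] {l : ℕ}
    (M : (Fin l ⊕ Fin l) → (Fin l ⊕ Fin l) → Prop)
    (hrefl : ∀ v, M v v)
    (hantisymm : ∀ u v, M u v → M v u → u = v)
    (htrans : ∀ u v w, M u v → M v w → M u w)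
    (hantichain : ∀ i j : Fin l, i ≠ j → ¬ M (Sum.inl i) (Sum.inl j))
    (hupsets : ∀ i j : Fin l, i ≠ j → ∀ v, M (Sum.inl i) v → ¬ M (Sum.inl j) v)
    (hdownsets : ∀ i j : Fin l, i ≠ j → ∀ v, M v (Sum.inl i) → ¬ M v (Sum.inl j))
    (hafter : ∀ i j : Fin l,
      (M (Sum.inl j) (Sum.inr i) ∨ M (Sum.inr i) (Sum.inl j)) → j.1 ≤ i.1)
    (p : α) (hp : (∀ m, IsMin m → m ≤ p) ∧ (∀ q, IsMax q → p ≤ q)) :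
    ∃ g : Strategy α l, ∀ f : Fin l → α, Beats M g f := by
  obtain ⟨up, hup⟩ := exists_isMax_above α
  obtain ⟨down, hdown⟩ := exists_isMin_below α
  refine ⟨extremalStrategy M hafter up down p, fun f => ?_⟩
  have eq_up : ∀ i j, M (Sum.inl j) (Sum.inr i) →
      induced (extremalStrategy M hafter up down p) f (Sum.inr i) = up (f j) := by
    intro i j hij
    have h : ∃ j, M (Sum.inl j) (Sum.inr i) := ⟨j, hij⟩
    have hj : h.choose = j := by
      by_contra hne
      exact hupsets _ _ hne _ h.choose_spec hij
    simp [induced, extremalStrategy, trunc, h, hj]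
  have not_above_below : ∀ i j k, M (Sum.inl j) (Sum.inr i) → ¬ M (Sum.inr i) (Sum.inl k) := by
    intro i j k hj hk
    obtain rfl : j = k := by
      by_contra hne
      exact hantichain _ _ hne (htrans _ _ _ hj hk)
    cases hantisymm _ _ hj hk
  have eq_down : ∀ i j, M (Sum.inr i) (Sum.inl j) →
      induced (extremalStrategy M hafter up down p) f (Sum.inr i) = down (f j) := by
    intro i j hij
    have h' : ¬ ∃ j, M (Sum.inl j) (Sum.inr i) := fun ⟨k, hk⟩ => not_above_below _ _ _ hk hij
    have h : ∃ j, M (Sum.inr i) (Sum.inl j) := ⟨j, hij⟩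
    have hj : h.choose = j := by
      by_contra hne
      exact hdownsets _ _ hne _ h.choose_spec hij
    simp only [induced, extremalStrategy, trunc, dif_neg h', dif_pos h, hj]
  have eq_default : ∀ i, (¬ ∃ j, M (Sum.inl j) (Sum.inr i)) →
      (¬ ∃ j, M (Sum.inr i) (Sum.inl j)) →
      induced (extremalStrategy M hafter up down p) f (Sum.inr i) = p := by
    intro i h h'
    simp only [induced, extremalStrategy, dif_neg h, dif_neg h']
  have le_default : ∀ i, (¬ ∃ j, M (Sum.inl j) (Sum.inr i)) →
      induced (extremalStrategy M hafter up down p) f (Sum.inr i) ≤ p := by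
    intro i h
    by_cases h' : ∃ j, M (Sum.inr i) (Sum.inl j)
    · obtain ⟨j, hj⟩ := h'
      exact (eq_down i j hj).trans_le (hp.1 _ (hdown _).2)
    · exact (eq_default i h h').le
  have default_le : ∀ i, (¬ ∃ j, M (Sum.inr i) (Sum.inl j)) →
      p ≤ induced (extremalStrategy M hafter up down p) f (Sum.inr i) := by
    intro i h
    by_cases h' : ∃ j, M (Sum.inl j) (Sum.inr i)
    · obtain ⟨j, hj⟩ := h'
      exact (hp.2 _ (hup _).2).trans_eq (eq_up i j hj).symm
    · exact (eq_default i h' h).ge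
  rintro (i | i) (k | k) hM
  · obtain rfl : i = k := by
      by_contra hne
      exact hantichain _ _ hne hM
    exact le_rfl
  · exact (hup (f i)).1.trans_eq (eq_up k i hM).symm
  · exact (eq_down i k hM).trans_le (hdown (f k)).1
  · by_cases h : ∃ j, M (Sum.inl j) (Sum.inr i)
    · obtain ⟨j, hj⟩ := h
      rw [eq_up i j hj, eq_up k j (htrans _ _ _ hj hM)]
    · by_cases h' : ∃ j, M (Sum.inr k) (Sum.inl j)
      · obtain ⟨j, hj⟩ := h'
        rw [eq_down i j (htrans _ _ _ hM hj), eq_down k j hj]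
      · exact (le_default i h).trans (default_le k h')
end

section
/- Let P be a finite nonempty poset of width w and let k ≥ 0. Then the set P_k of the layered construction on P satisfies |P_k| ≤ 2·w^{(3w)^k}. -/
section Layers

variable {α : Type*} [PartialOrder α]

/-- Minimal elements of the restriction of the poset to `S`. -/
def minsOf (S : Set α) : Set α := {p | p ∈ S ∧ ∀ q ∈ S, q ≤ p → q = p}

/-- Maximal elements of the restriction of the poset to `S`. -/
def maxsOf (S : Set α) : Set α := {p | p ∈ S ∧ ∀ q ∈ S, p ≤ q → p = q}

/-- One step of the layered construction: given `(L_{i-1}, U_{i-1})`, produce `(L_i, U_i)`.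
`R` ranges over the subsets of `P_{i-1} = L_{i-1} ∪ U_{i-1}` such that `R ∩ L_{i-1}` is
downward closed in the restriction to `L_{i-1}` and `R ∩ U_{i-1}` is upward closed in the
restriction to `U_{i-1}`; `P_{i-1,R}` consists of the `p` whose relations to `L_{i-1}` and
`U_{i-1}` are described exactly by `R`. -/
def layerStep (LU : Set α × Set α) : Set α × Set α :=
  let L := LU.1
  let U := LU.2
  let Adm : Set (Set α) := {R | R ⊆ L ∪ U ∧
    (∀ l ∈ L, ∀ l' ∈ L, l ∈ R → l' ≤ l → l' ∈ R) ∧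
    (∀ u ∈ U, ∀ u' ∈ U, u ∈ R → u ≤ u' → u' ∈ R)}
  let PR : Set α → Set α := fun R =>
    {p | (∀ l ∈ L, (l ≤ p ↔ l ∈ R)) ∧ (∀ u ∈ U, (p ≤ u ↔ u ∈ R))}
  let L' := L ∪ ⋃ R ∈ Adm, minsOf (PR R)
  let U' := (U ∪ ⋃ R ∈ Adm, maxsOf (PR R)) \ L'
  (L', U')

/-- The pair `(L_i, U_i)` of the layered construction. -/
def layers : ℕ → Set α × Set α
  | 0 => ({p | IsMin p}, {p | IsMax p} \ {p | IsMin p})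
  | (i + 1) => layerStep (layers i)

/-- The set `P_i = L_i ∪ U_i` of the layered construction. -/
def Pset (i : ℕ) : Set α := (layers i).1 ∪ (layers i).2

end Layers

section LayerBounds

variable {α : Type*} [PartialOrder α]

/-- The elements of `S` below `p`. -/
def traceBelow (S : Set α) (p : α) : Set α := {s | s ∈ S ∧ s ≤ p}

/-- The elements of `S` above `p`. -/
def traceAbove (S : Set α) (p : α) : Set α := {s | s ∈ S ∧ p ≤ s}

/-- In a finite poset of width at most `w`, there are at most `|S| ^ w` nonempty traces of
principal lower sets on `S`: each is generated by its maximal elements. -/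
theorem ncard_nonempty_traceBelow_le [Finite α] {w : ℕ}
    (hw : ∀ A : Set α, IsAntichain (· ≤ ·) A → A.ncard ≤ w) (S : Set α) :
    {D | D.Nonempty ∧ ∃ p, D = traceBelow S p}.ncard ≤ S.ncard ^ w := by
  let gen : (Fin w → S) → Set α := fun f => {s | s ∈ S ∧ ∃ i, s ≤ f i}
  have hsub : {D | D.Nonempty ∧ ∃ p, D = traceBelow S p} ⊆ Set.range gen := by
    rintro D ⟨hne, p, rfl⟩
    have hfin : (traceBelow S p).Finite := Set.toFinite _
    let A : Set α := {a | Maximal (· ∈ traceBelow S p) a}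
    have hA : IsAntichain (· ≤ ·) A := setOfPred_maximal_antichain _
    obtain ⟨a₀, ha₀⟩ : A.Nonempty := hfin.exists_maximal hne
    have : Nonempty A := ⟨⟨a₀, ha₀⟩⟩
    have hcard : Nat.card A ≤ Nat.card (Fin w) := by
      simpa [Nat.card_coe_set_eq] using hw A hA
    obtain ⟨e⟩ : Nonempty (A ↪ Fin w) := by
      have := Fintype.ofFinite A
      refine Function.Embedding.nonempty_of_card_le ?_
      simpa [Nat.card_eq_fintype_card] using hcard
    have hinv := Function.leftInverse_invFun e.injective
    refine ⟨fun i => ⟨(Function.invFun e i).1, (Function.invFun e i).2.prop.1⟩, ?_⟩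
    ext s
    constructor
    · rintro ⟨hs, i, hi⟩
      exact ⟨hs, hi.trans (Function.invFun e i).2.prop.2⟩
    · intro hs
      obtain ⟨m, hsm, hm⟩ := hfin.exists_le_maximal hs
      refine ⟨hs.1, e ⟨m, hm⟩, ?_⟩
      simpa [hinv ⟨m, hm⟩] using hsm
  calc _ ≤ (Set.range gen).ncard := Set.ncard_le_ncard hsub (Set.toFinite _)
    _ ≤ Nat.card (Fin w → S) := by
      rw [← Set.image_univ, ← Set.ncard_univ]
      exact Set.ncard_image_le (Set.toFinite _)
    _ = S.ncard ^ w := by simp [Nat.card_fun, Nat.card_coe_set_eq]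

/-- There are at most `|S| ^ w` nonempty traces of principal upper sets on `S`. -/
theorem ncard_nonempty_traceAbove_le [Finite α] {w : ℕ}
    (hw : ∀ A : Set α, IsAntichain (· ≤ ·) A → A.ncard ≤ w) (S : Set α) :
    {E | E.Nonempty ∧ ∃ p, E = traceAbove S p}.ncard ≤ S.ncard ^ w :=
  ncard_nonempty_traceBelow_le (α := αᵒᵈ) (fun A hA => hw A hA.flip) S

/-- A set whose members with equal traces on `L` and `U` are incomparable is small. -/
theorem ncard_le_of_trace_fibers_antichain [Finite α] {w : ℕ}
    (hw : ∀ A : Set α, IsAntichain (· ≤ ·) A → A.ncard ≤ w) {L U T : Set α}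
    (hL : ∀ p : α, (traceBelow L p).Nonempty)
    (hT : ∀ p ∈ T, ∀ q ∈ T, traceBelow L p = traceBelow L q →
      traceAbove U p = traceAbove U q → p ≤ q → p = q) :
    T.ncard ≤ w * (L.ncard ^ w * (U.ncard ^ w + 1)) := by
  classical
  have := Fintype.ofFinite α
  let f : α → Set α × Set α := fun p => (traceBelow L p, traceAbove U p)
  let D : Set (Set α) := {D | D.Nonempty ∧ ∃ p, D = traceBelow L p}
  let E : Set (Set α) := {E | E.Nonempty ∧ ∃ p, E = traceAbove U p}
  have himage : f '' T ⊆ D ×ˢ insert ∅ E := by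
    rintro _ ⟨p, -, rfl⟩
    refine ⟨⟨hL p, p, rfl⟩, ?_⟩
    rcases Set.eq_empty_or_nonempty (traceAbove U p) with h | h
    · exact Or.inl h
    · exact Or.inr ⟨h, p, rfl⟩
  have hcard : T.toFinset.card ≤ w * (T.toFinset.image f).card := by
    refine Finset.card_le_mul_card_image _ _ fun a _ => ?_
    rw [← Set.ncard_coe_finset]
    refine hw _ fun p hp q hq hne hpq => hne ?_
    simp only [Finset.coe_filter, Set.mem_toFinset, Set.mem_ofPred_eq] at hp hq
    have hpq' : f p = f q := hp.2.trans hq.2.symm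
    exact hT p hp.1 q hq.1 (congrArg Prod.fst hpq') (congrArg Prod.snd hpq') hpq
  rw [← Set.ncard_eq_toFinset_card', ← Set.ncard_coe_finset] at hcard
  simp only [Finset.coe_image, Set.coe_toFinset] at hcard
  refine hcard.trans (Nat.mul_le_mul_left _ ?_)
  calc (f '' T).ncard ≤ (D ×ˢ insert ∅ E).ncard := Set.ncard_le_ncard himage (Set.toFinite _)
    _ = D.ncard * (insert ∅ E).ncard := Set.ncard_prod
    _ ≤ L.ncard ^ w * (U.ncard ^ w + 1) :=
      Nat.mul_le_mul (ncard_nonempty_traceBelow_le hw L)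
        ((Set.ncard_insert_le _ _).trans
          (Nat.add_le_add_right (ncard_nonempty_traceAbove_le hw U) 1))

/-- An element of the new lower layer is minimal among the elements with the same traces. -/
theorem eq_of_mem_layerStep_fst {L U : Set α} {p q : α} (hq : q ∈ (layerStep (L, U)).1)
    (hL : traceBelow L p = traceBelow L q) (hU : traceAbove U p = traceAbove U q)
    (hpq : p ≤ q) : p = q := by
  rcases hq with hq | hq
  · have : q ∈ traceBelow L p := hL ▸ ⟨hq, le_rfl⟩
    exact le_antisymm hpq this.2
  · simp only [Set.mem_iUnion] at hq
    obtain ⟨R, -, ⟨hqL, hqU⟩, hmin⟩ := hq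
    refine hmin p ⟨fun l hl => ?_, fun u hu => ?_⟩ hpq
    · rw [← hqL l hl]
      simpa [traceBelow, hl] using Set.ext_iff.1 hL l
    · rw [← hqU u hu]
      simpa [traceAbove, hu] using Set.ext_iff.1 hU u

/-- An element of the new upper layer is maximal among the elements with the same traces. -/
theorem eq_of_mem_layerStep_snd {L U : Set α} {p q : α} (hp : p ∈ (layerStep (L, U)).2)
    (hL : traceBelow L p = traceBelow L q) (hU : traceAbove U p = traceAbove U q)
    (hpq : p ≤ q) : p = q := by
  rcases hp.1 with hp | hp
  · have : p ∈ traceAbove U q := hU ▸ ⟨hp, le_rfl⟩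
    exact le_antisymm hpq this.2
  · simp only [Set.mem_iUnion] at hp
    obtain ⟨R, -, ⟨hpL, hpU⟩, hmax⟩ := hp
    refine hmax q ⟨fun l hl => ?_, fun u hu => ?_⟩ hpq
    · rw [← hpL l hl]
      simpa [traceBelow, hl] using (Set.ext_iff.1 hL l).symm
    · rw [← hpU u hu]
      simpa [traceAbove, hu] using (Set.ext_iff.1 hU u).symm

theorem mem_layers_fst_of_isMin {p : α} (hp : IsMin p) (k : ℕ) : p ∈ (layers k).1 := by
  induction k with
  | zero => exact hp
  | succ k ih => exact Or.inl ih

theorem traceBelow_layers_nonempty [Finite α] (k : ℕ) (p : α) :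
    (traceBelow (layers k).1 p).Nonempty := by
  obtain ⟨m, hmp, hm⟩ := (Set.toFinite (Set.univ : Set α)).exists_le_minimal (Set.mem_univ p)
  exact ⟨m, mem_layers_fst_of_isMin (fun q hq => hm.2 (Set.mem_univ q) hq) k, hmp⟩

/-- In a total order the layers never grow beyond the extremal elements. -/
theorem layers_subset_of_total (htot : ∀ p q : α, p ≤ q ∨ q ≤ p) (k : ℕ) :
    (∀ p ∈ (layers k : Set α × Set α).1, IsMin p) ∧
      ∀ p ∈ (layers k : Set α × Set α).2, IsMax p := by
  induction k with
  | zero => exact ⟨fun p hp => hp, fun p hp => hp.1⟩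
  | succ k ih =>
    have hbot : ∀ l ∈ (layers k : Set α × Set α).1, ∀ p, l ≤ p := fun l hl p =>
      (htot l p).elim id fun h => ih.1 l hl h
    have htop : ∀ u ∈ (layers k : Set α × Set α).2, ∀ p, p ≤ u := fun u hu p =>
      (htot p u).elim id fun h => ih.2 u hu h
    have hD : ∀ p q : α, traceBelow (layers k).1 p = traceBelow (layers k).1 q := fun p q =>
      Set.ext fun s => ⟨fun h => ⟨h.1, hbot s h.1 q⟩, fun h => ⟨h.1, hbot s h.1 p⟩⟩
    have hE : ∀ p q : α, traceAbove (layers k).2 p = traceAbove (layers k).2 q := fun p q =>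
      Set.ext fun s => ⟨fun h => ⟨h.1, htop s h.1 q⟩, fun h => ⟨h.1, htop s h.1 p⟩⟩
    exact ⟨fun p hp q hqp => (eq_of_mem_layerStep_fst hp (hD q p) (hE q p) hqp).ge,
      fun p hp q hpq => (eq_of_mem_layerStep_snd hp (hD p q) (hE p q) hpq).ge⟩

/-- The numerical step of the recursion for layer sizes. -/
theorem layer_bound_step {w m a b : ℕ} (hw : 2 ≤ w) (hm : 1 ≤ m) (ha : a ≤ w ^ m)
    (hb : b ≤ w ^ m) : w * (a ^ w * (b ^ w + 1)) ≤ w ^ (m * (3 * w)) := by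
  have hone : 1 ≤ w ^ (m * w) := Nat.one_le_pow _ _ (by omega)
  have hexp : 2 ≤ m * w := by nlinarith
  calc w * (a ^ w * (b ^ w + 1)) ≤ w * ((w ^ m) ^ w * ((w ^ m) ^ w + 1)) := by gcongr
    _ = w * (w ^ (m * w) * (w ^ (m * w) + 1)) := by rw [← pow_mul]
    _ ≤ w * (w ^ (m * w) * (w * w ^ (m * w))) := by gcongr; nlinarith
    _ = w ^ (m * w + m * w + 2) := by ring
    _ ≤ w ^ (m * (3 * w)) := Nat.pow_le_pow_right (by omega) (by nlinarith)

theorem ncard_layers_le [Finite α] {w : ℕ} (hpos : 1 ≤ w)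
    (hw : ∀ A : Set α, IsAntichain (· ≤ ·) A → A.ncard ≤ w) (k : ℕ) :
    (layers k : Set α × Set α).1.ncard ≤ w ^ (3 * w) ^ k ∧
      (layers k : Set α × Set α).2.ncard ≤ w ^ (3 * w) ^ k := by
  have hmin : ∀ A : Set α, (∀ p ∈ A, IsMin p) → A.ncard ≤ w := fun A hA =>
    hw A fun p _ q hq hne hpq => hne ((hA q hq).eq_of_le hpq)
  have hmax : ∀ A : Set α, (∀ p ∈ A, IsMax p) → A.ncard ≤ w := fun A hA =>
    hw A fun p hp q _ hne hpq => hne ((hA p hp).eq_of_le hpq)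
  rcases hpos.eq_or_lt with rfl | htwo
  · have htot : ∀ p q : α, p ≤ q ∨ q ≤ p := by
      intro p q
      by_contra! h
      have hne : p ≠ q := fun e => h.1 e.le
      have := hw {p, q} (by
        rintro x (rfl | rfl) y (rfl | rfl) hxy
        exacts [absurd rfl hxy, h.1, h.2, absurd rfl hxy])
      rw [Set.ncard_pair hne] at this
      omega
    obtain ⟨h₁, h₂⟩ := layers_subset_of_total htot k
    simpa using And.intro (hmin _ h₁) (hmax _ h₂)
  · induction k with
    | zero =>
      simpa using And.intro (hmin (layers 0).1 fun p hp => hp) (hmax (layers 0).2 fun p hp => hp.1)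
    | succ k ih =>
      have hstep := layer_bound_step htwo (Nat.one_le_pow k _ (by omega)) ih.1 ih.2
      rw [pow_succ]
      constructor
      · exact (ncard_le_of_trace_fibers_antichain hw (traceBelow_layers_nonempty k)
          fun p _ q hq => eq_of_mem_layerStep_fst hq).trans hstep
      · exact (ncard_le_of_trace_fibers_antichain hw (traceBelow_layers_nonempty k)
          fun p hp q _ => eq_of_mem_layerStep_snd hp).trans hstep

end LayerBounds

/-- Let `P` be a finite nonempty poset of width `w` and let `k ≥ 0`.  Then the
set `P_k` of the layered construction on `P` satisfies `|P_k| ≤ 2 · w^((3w)^k)`. -/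
theorem stmt_2 {α : Type*} [PartialOrder α] [Fintype α] [Nonempty α] (w k : ℕ)
    (hw : IsGreatest {n | ∃ A : Set α, IsAntichain (· ≤ ·) A ∧ A.ncard = n} w) :
    (Pset k : Set α).ncard ≤ 2 * w ^ (3 * w) ^ k := by
  have hbound : ∀ A : Set α, IsAntichain (· ≤ ·) A → A.ncard ≤ w := fun A hA =>
    hw.2 ⟨A, hA, rfl⟩
  obtain ⟨a⟩ := ‹Nonempty α›
  have hpos : 1 ≤ w := by
    simpa using hbound {a} (Set.subsingleton_singleton.isAntichain _)
  obtain ⟨h₁, h₂⟩ := ncard_layers_le hpos hbound k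
  have := Set.ncard_union_le (layers k : Set α × Set α).1 (layers k).2
  unfold Pset
  omega
end

section
/- A finite poset with n elements and width at most w has at most (n+1)^w antichains, and hence at most (n+1)^w lower sets. -/
/-- A finite type with `n` elements has at most `(n + 1) ^ w` subsets of size at most `w`. -/
theorem ncard_setOf_ncard_le {α : Type*} [Fintype α] (w : ℕ) :
    {A : Set α | A.ncard ≤ w}.ncard ≤ (Fintype.card α + 1) ^ w := by
  classical
  let support : (Fin w → Option α) → Set α := fun f => {a | ∃ i, f i = some a}
  have hsub : {A : Set α | A.ncard ≤ w} ⊆ support '' Set.univ := by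
    intro A hA
    obtain ⟨e⟩ : Nonempty (A ↪ Fin w) := by
      apply Function.Embedding.nonempty_of_card_le
      rw [Fintype.card_fin, ← Nat.card_eq_fintype_card]
      exact hA
    refine ⟨fun i => (Function.partialInv e i).map Subtype.val, trivial, ?_⟩
    ext a
    simp only [support, Set.mem_ofPred_eq, Option.map_eq_some_iff,
      e.injective.isPartialInv _ _]
    simp
  calc {A : Set α | A.ncard ≤ w}.ncard
      ≤ (support '' Set.univ).ncard := Set.ncard_le_ncard hsub
    _ ≤ (Set.univ : Set (Fin w → Option α)).ncard := Set.ncard_image_le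
    _ = (Fintype.card α + 1) ^ w := by simp [Set.ncard_univ]

/-- In a finite poset, a lower set is determined by its maximal elements. -/
theorem IsLowerSet.injOn_setOf_maximal {α : Type*} [PartialOrder α] [Finite α] :
    Set.InjOn (fun S : Set α => {x | Maximal (· ∈ S) x}) {S | IsLowerSet S} := by
  have key : ∀ S T : Set α, IsLowerSet T →
      {x | Maximal (· ∈ S) x} = {x | Maximal (· ∈ T) x} → S ⊆ T := by
    intro S T hT h x hx
    obtain ⟨m, hxm, hm⟩ := S.toFinite.exists_le_maximal hx
    have hmT : m ∈ {x | Maximal (· ∈ T) x} := h ▸ hm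
    exact hT hxm hmT.prop
  intro S hS T hT h
  exact (key S T hT h).antisymm (key T S hS h.symm)

/-- A finite poset with `n` elements and width at most `w` has at most
`(n+1)^w` antichains, and hence at most `(n+1)^w` lower sets. -/
theorem stmt_4 {α : Type*} [PartialOrder α] [Fintype α] (n w : ℕ)
    (hn : Fintype.card α = n)
    (hw : ∀ A : Set α, IsAntichain (· ≤ ·) A → A.ncard ≤ w) :
    {A : Set α | IsAntichain (· ≤ ·) A}.ncard ≤ (n + 1) ^ w ∧
    {S : Set α | IsLowerSet S}.ncard ≤ (n + 1) ^ w := by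
  subst hn
  have hA : {A : Set α | IsAntichain (· ≤ ·) A}.ncard ≤ (Fintype.card α + 1) ^ w :=
    (Set.ncard_le_ncard hw).trans (ncard_setOf_ncard_le w)
  refine ⟨hA, le_trans ?_ hA⟩
  exact Set.ncard_le_ncard_of_injOn _ (fun S _ => setOfPred_maximal_antichain _)
    IsLowerSet.injOn_setOf_maximal
end

section
/- For every trivial assignment f : {y_0,y_1,y_2,y_3} → B, there exists an assignment f' of all twelve variables of α extending f that satisfies every atom of α in B and moreover satisfies f'(w_0) = f'(w_1) = f'(w_2) = f'(w_3). -/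
/-- The order of the bowtie poset `B` on `{0,1,2,3}`: reflexive pairs together with
`0 < 1`, `0 < 3`, `2 < 1`, `2 < 3` (so `0,2` are incomparable and `1,3` are incomparable). -/
def Ble (a b : Fin 4) : Prop := a = b ∨ ((a = 0 ∨ a = 2) ∧ (b = 1 ∨ b = 3))

/-- The assignment `x_i ↦ x i`, `y_i ↦ y i`, `w_i ↦ w i` satisfies every atom of the
conjunction `α` in `B`. -/
def AlphaSat (x y w : Fin 4 → Fin 4) : Prop :=
  Ble (w 0) (w 1) ∧ Ble (w 0) (w 3) ∧ Ble (w 2) (w 1) ∧ Ble (w 2) (w 3) ∧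
  Ble (x 0) (y 0) ∧ Ble (x 0) (w 0) ∧ Ble (x 2) (y 2) ∧ Ble (x 2) (w 2) ∧
  Ble (y 1) (x 1) ∧ Ble (w 1) (x 1) ∧ Ble (y 3) (x 3) ∧ Ble (w 3) (x 3)

/-- The assignment `y_i ↦ f i` is nontrivial: `{f y_0, f y_2} = {0,2}` and
`{f y_1, f y_3} = {1,3}`. -/
def NontrivialAssign (f : Fin 4 → Fin 4) : Prop :=
  ({f 0, f 2} : Set (Fin 4)) = {0, 2} ∧ ({f 1, f 3} : Set (Fin 4)) = {1, 3}

instance (a b : Fin 4) : Decidable (Ble a b) := by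
  unfold Ble
  infer_instance

/-- Two elements other than the two minimal ones have a common lower bound, which moreover
has a common upper bound with every element. -/
theorem exists_common_lower_bound (a b : Fin 4) (h : ({a, b} : Set (Fin 4)) ≠ {0, 2}) :
    ∃ m, Ble m a ∧ Ble m b ∧ ∀ c, ∃ u, Ble c u ∧ Ble m u := by
  have key : ∀ a b : Fin 4, (a = 0 ∧ b = 2 ∨ a = 2 ∧ b = 0) ∨
      ∃ m, Ble m a ∧ Ble m b ∧ ∀ c, ∃ u, Ble c u ∧ Ble m u := by decide
  rcases key a b with (⟨rfl, rfl⟩ | ⟨rfl, rfl⟩) | hm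
  · exact absurd rfl h
  · exact absurd (Set.pair_comm _ _) h
  · exact hm

/-- Two elements other than the two maximal ones have a common upper bound, which moreover
has a common lower bound with every element. -/
theorem exists_common_upper_bound (a b : Fin 4) (h : ({a, b} : Set (Fin 4)) ≠ {1, 3}) :
    ∃ m, Ble a m ∧ Ble b m ∧ ∀ c, ∃ l, Ble l c ∧ Ble l m := by
  have key : ∀ a b : Fin 4, (a = 1 ∧ b = 3 ∨ a = 3 ∧ b = 1) ∨
      ∃ m, Ble a m ∧ Ble b m ∧ ∀ c, ∃ l, Ble l c ∧ Ble l m := by decide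
  rcases key a b with (⟨rfl, rfl⟩ | ⟨rfl, rfl⟩) | hm
  · exact absurd rfl h
  · exact absurd (Set.pair_comm _ _) h
  · exact hm

/-- For every trivial assignment `f : {y_0,y_1,y_2,y_3} → B` there is an
extension `f'` to all twelve variables of `α` satisfying every atom of `α` in `B` with
`f'(w_0) = f'(w_1) = f'(w_2) = f'(w_3)`. -/
theorem stmt_8 (f : Fin 4 → Fin 4) (hf : ¬ NontrivialAssign f) :
    ∃ x w : Fin 4 → Fin 4, AlphaSat x f w ∧
      w 0 = w 1 ∧ w 1 = w 2 ∧ w 2 = w 3 := by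
  have refl (a : Fin 4) : Ble a a := Or.inl rfl
  rcases not_and_or.mp hf with h | h
  · obtain ⟨m, h0, h2, hm⟩ := exists_common_lower_bound _ _ h
    obtain ⟨u, hu, hmu⟩ := hm (f 1)
    obtain ⟨v, hv, hmv⟩ := hm (f 3)
    exact ⟨![m, u, m, v], fun _ => m, ⟨refl m, refl m, refl m, refl m, h0, refl m, h2, refl m,
      hu, hmu, hv, hmv⟩, rfl, rfl, rfl⟩
  · obtain ⟨m, h1, h3, hm⟩ := exists_common_upper_bound _ _ h
    obtain ⟨u, hu, hum⟩ := hm (f 0)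
    obtain ⟨v, hv, hvm⟩ := hm (f 2)
    exact ⟨![u, m, v, m], fun _ => m, ⟨refl m, refl m, refl m, refl m, hu, hum, hv, hvm,
      h1, refl m, h3, refl m⟩, rfl, rfl, rfl⟩
end

section
/- Let W be a finite set of variables disjoint from the variables of α, and let S be a finite set of atoms, each of the form u ≤ u' with u, u' ∈ W, or w_i ≤ u, or u ≤ w_i with u ∈ W and i ∈ {0,1,2,3}. Then for every trivial assignment f : {y_0,y_1,y_2,y_3} → B, there exists an assignment of all variables of α and of W extending f that satisfies every atom of α and every atom of S in B. -/
/-- Evaluation of a term of an atom of `S'`: a variable `u ∈ W` (via `Sum.inl`) is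
evaluated by `h`, and the variable `w_i` (via `Sum.inr i`) is evaluated by `w`. -/
def evalW {W : Type*} (h : W → Fin 4) (w : Fin 4 → Fin 4) : W ⊕ Fin 4 → Fin 4
  | Sum.inl u => h u
  | Sum.inr i => w i

instance inst_s9 (a b : Fin 4) : Decidable (Ble a b) := by
  unfold Ble; infer_instance

theorem Ble.refl (a : Fin 4) : Ble a a := Or.inl rfl

set_option synthInstance.maxHeartbeats 400000 in
set_option synthInstance.maxSize 1000 in
/-- Unless `{a, b} = {0, 2}` and `{c, d} = {1, 3}`, some element of the bowtie has a common
lower bound with each of `a`, `b` and a common upper bound with each of `c`, `d`. -/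
theorem exists_common_bounds (a b c d : Fin 4)
    (h : ¬ (((a = 0 ∧ b = 2) ∨ (a = 2 ∧ b = 0)) ∧ ((c = 1 ∧ d = 3) ∨ (c = 3 ∧ d = 1)))) :
    ∃ e, (∃ z, Ble z a ∧ Ble z e) ∧ (∃ z, Ble z b ∧ Ble z e) ∧
      (∃ z, Ble c z ∧ Ble e z) ∧ (∃ z, Ble d z ∧ Ble e z) := by
  revert a b c d
  decide +kernel

/-- Let `W` be a finite set of variables disjoint from the variables of `α`
and `S` a finite set of atoms, each of the form `u ≤ u'` with `u, u' ∈ W`, or `w_i ≤ u`,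
or `u ≤ w_i` with `u ∈ W` (i.e. at least one side of each atom is in `W`).  Then for every
trivial assignment `f` of `{y_0,…,y_3}` there is an assignment of all variables of `α` and
of `W` extending `f` satisfying every atom of `α` and of `S` in `B`. -/
theorem stmt_9 {W : Type*} [Fintype W]
    (S : Set ((W ⊕ Fin 4) × (W ⊕ Fin 4)))
    (hS : ∀ a ∈ S, (∃ u : W, a.1 = Sum.inl u) ∨ (∃ u : W, a.2 = Sum.inl u))
    (f : Fin 4 → Fin 4) (hf : ¬ NontrivialAssign f) :
    ∃ (x w : Fin 4 → Fin 4) (h : W → Fin 4), AlphaSat x f w ∧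
      ∀ a ∈ S, Ble (evalW h w a.1) (evalW h w a.2) := by
  obtain ⟨e, ⟨z₀, h₀, h₀'⟩, ⟨z₂, h₂, h₂'⟩, ⟨z₁, h₁, h₁'⟩, ⟨z₃, h₃, h₃'⟩⟩ :=
    exists_common_bounds (f 0) (f 2) (f 1) (f 3) fun h ↦
      hf ⟨Set.pair_eq_pair_iff.2 h.1, Set.pair_eq_pair_iff.2 h.2⟩
  refine ⟨![z₀, z₁, z₂, z₃], fun _ ↦ e, fun _ ↦ e,
    ⟨.refl e, .refl e, .refl e, .refl e, h₀, h₀', h₂, h₂', h₁, h₁', h₃, h₃'⟩, ?_⟩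
  rintro ⟨_ | _, _ | _⟩ - <;> exact .refl e
end

section
/- Let f : {y_0,y_1,y_2,y_3} → B be a nontrivial assignment. Then: (i) there exists an assignment f' of all twelve variables of α extending f that satisfies every atom of α in B; (ii) every assignment f' of all twelve variables of α extending f that satisfies every atom of α in B satisfies {f'(w_0), f'(w_2)} = {0,2} and {f'(w_1), f'(w_3)} = {1,3}. -/
theorem Ble.trans {a b c : Fin 4} (hab : Ble a b) (hbc : Ble b c) : Ble a c := by
  unfold Ble at *
  grind

theorem Ble.eq_of_minimal {a b : Fin 4} (h : Ble a b) (hb : b = 0 ∨ b = 2) : a = b := by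
  unfold Ble at h
  grind

theorem Ble.eq_of_maximal {a b : Fin 4} (h : Ble a b) (ha : a = 1 ∨ a = 3) : a = b := by
  unfold Ble at h
  grind

/-- A minimal element `m` is the only element above `m` and below both `1` and `3`. -/
theorem eq_of_ble_one_three {m a : Fin 4} (hm : m = 0 ∨ m = 2) (hma : Ble m a)
    (h1 : Ble a 1) (h3 : Ble a 3) : a = m := by
  unfold Ble at *
  grind

/-- A maximal element `m` is the only element below `m` and above both `0` and `2`. -/
theorem eq_of_zero_two_ble {m a : Fin 4} (hm : m = 1 ∨ m = 3) (ham : Ble a m)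
    (h0 : Ble 0 a) (h2 : Ble 2 a) : a = m := by
  unfold Ble at *
  grind

/-- For a nontrivial `y`, every satisfying assignment of `α` has `w = y`. -/
theorem AlphaSat.eq_of_nontrivial {x y w : Fin 4 → Fin 4} (h : AlphaSat x y w)
    (hy : NontrivialAssign y) : w 0 = y 0 ∧ w 2 = y 2 ∧ w 1 = y 1 ∧ w 3 = y 3 := by
  obtain ⟨h01, h03, h21, h23, hx0, hw0, hx2, hw2, hx1, hw1, hx3, hw3⟩ := h
  obtain ⟨hmin, hmax⟩ := hy
  rw [Set.pair_eq_pair_iff] at hmin hmax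
  have m0 : y 0 = 0 ∨ y 0 = 2 := hmin.imp And.left And.left
  have m2 : y 2 = 0 ∨ y 2 = 2 := (hmin.imp And.right And.right).symm
  have m1 : y 1 = 1 ∨ y 1 = 3 := hmax.imp And.left And.left
  have m3 : y 3 = 1 ∨ y 3 = 3 := (hmax.imp And.right And.right).symm
  rw [hx0.eq_of_minimal m0] at hw0
  rw [hx2.eq_of_minimal m2] at hw2
  rw [← hx1.eq_of_maximal m1] at hw1
  rw [← hx3.eq_of_maximal m3] at hw3
  have below {a : Fin 4} (h1 : Ble a (w 1)) (h3 : Ble a (w 3)) : Ble a 1 ∧ Ble a 3 := by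
    have := h1.trans hw1
    have := h3.trans hw3
    grind
  have above {a : Fin 4} (h0 : Ble (w 0) a) (h2 : Ble (w 2) a) : Ble 0 a ∧ Ble 2 a := by
    have := hw0.trans h0
    have := hw2.trans h2
    grind
  exact ⟨eq_of_ble_one_three m0 hw0 (below h01 h03).1 (below h01 h03).2,
    eq_of_ble_one_three m2 hw2 (below h21 h23).1 (below h21 h23).2,
    eq_of_zero_two_ble m1 hw1 (above h01 h21).1 (above h01 h21).2,
    eq_of_zero_two_ble m3 hw3 (above h03 h23).1 (above h03 h23).2⟩

/-- For a nontrivial `y`, setting `x = w = y` satisfies `α`. -/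
theorem NontrivialAssign.alphaSat {y : Fin 4 → Fin 4} (hy : NontrivialAssign y) :
    AlphaSat y y y := by
  obtain ⟨hmin, hmax⟩ := hy
  rw [Set.pair_eq_pair_iff] at hmin hmax
  unfold AlphaSat Ble
  grind

/-- Let `f : {y_0,…,y_3} → B` be a nontrivial assignment.  Then (i) some
extension of `f` to all twelve variables of `α` satisfies every atom of `α` in `B`, and
(ii) every such satisfying extension `f'` has `{f'(w_0), f'(w_2)} = {0,2}` and
`{f'(w_1), f'(w_3)} = {1,3}`. -/
theorem stmt_10 (f : Fin 4 → Fin 4) (hf : NontrivialAssign f) :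
    (∃ x w : Fin 4 → Fin 4, AlphaSat x f w) ∧
    (∀ x w : Fin 4 → Fin 4, AlphaSat x f w →
      ({w 0, w 2} : Set (Fin 4)) = {0, 2} ∧ ({w 1, w 3} : Set (Fin 4)) = {1, 3}) := by
  refine ⟨⟨f, f, hf.alphaSat⟩, fun x w h => ?_⟩
  obtain ⟨h0, h2, h1, h3⟩ := h.eq_of_nontrivial hf
  rw [h0, h2, h1, h3]
  exact hf
end

section
/- Let W be a finite set of variables disjoint from the variables of α, let S be a finite set of atoms, each of the form u ≤ u' with u, u' ∈ W, or c_i ≤ u, or u ≤ c_i with u ∈ W and i ∈ {0,1,2,3}, and let S' be obtained from S by replacing each constant c_i by the variable w_i. Then for every nontrivial assignment f : {y_0,y_1,y_2,y_3} → B, the following are equivalent: (i) there exists an assignment of the variables {x_0,x_1,x_2,x_3,w_0,w_1,w_2,w_3} ∪ W extending f that satisfies every atom of α and every atom of S' in B; (ii) there exists g : W → {0,1,2,3} such that every atom of S holds in B when each constant c_i is interpreted as the element i. -/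
/-- Evaluation of a term of an atom of `S`: a variable `u ∈ W` is evaluated by `g`, and
the constant `c_i` is interpreted as the element `i` of `B`. -/
def evalC {W : Type*} (g : W → Fin 4) : W ⊕ Fin 4 → Fin 4
  | Sum.inl u => g u
  | Sum.inr i => i

instance : DecidableRel Ble := fun a b => by
  unfold Ble
  infer_instance

lemma NontrivialAssign.values {f : Fin 4 → Fin 4} (hf : NontrivialAssign f) :
    ((f 0 = 0 ∧ f 2 = 2) ∨ (f 0 = 2 ∧ f 2 = 0)) ∧
      ((f 1 = 1 ∧ f 3 = 3) ∨ (f 1 = 3 ∧ f 3 = 1)) := by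
  obtain ⟨h₁, h₂⟩ := hf
  exact ⟨Set.pair_eq_pair_iff.mp h₁, Set.pair_eq_pair_iff.mp h₂⟩

/-- A nontrivial assignment, viewed as a self-map of `B`, is an involution. -/
lemma NontrivialAssign.involutive {f : Fin 4 → Fin 4} (hf : NontrivialAssign f) :
    Function.Involutive f := by
  obtain ⟨⟨h0, h2⟩ | ⟨h0, h2⟩, ⟨h1, h3⟩ | ⟨h1, h3⟩⟩ := hf.values <;>
    intro a <;> fin_cases a <;> simp [h0, h1, h2, h3]

/-- A nontrivial assignment, viewed as a self-map of `B`, is monotone. -/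
lemma NontrivialAssign.map_ble {f : Fin 4 → Fin 4} (hf : NontrivialAssign f) {a b : Fin 4}
    (hab : Ble a b) : Ble (f a) (f b) := by
  obtain rfl | ⟨ha, hb⟩ := hab
  · exact Or.inl rfl
  · have hv := hf.values
    right
    rcases ha with rfl | rfl <;> rcases hb with rfl | rfl <;> tauto

lemma NontrivialAssign.alphaSat_s11 {f : Fin 4 → Fin 4} (hf : NontrivialAssign f) :
    AlphaSat f f f := by
  have refl (a : Fin 4) : Ble a a := Or.inl rfl
  refine ⟨hf.map_ble ?_, hf.map_ble ?_, hf.map_ble ?_, hf.map_ble ?_, refl _, refl _, refl _,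
    refl _, refl _, refl _, refl _, refl _⟩ <;> decide

/-- The conjunction `α` forces `w_i` to take the value of `y_i` when the latter is nontrivial. -/
lemma AlphaSat.eq_of_nontrivialAssign {x f w : Fin 4 → Fin 4} (h : AlphaSat x f w)
    (hf : NontrivialAssign f) : w = f := by
  obtain ⟨h01, h03, h21, h23, hx0, hxw0, hx2, hxw2, hx1, hxw1, hx3, hxw3⟩ := h
  have hv := hf.values
  unfold Ble at *
  funext i
  fin_cases i <;> simp only [Fin.zero_eta, Fin.mk_one, Fin.reduceFinMk] <;>
    grind (splits := 20)

/-- Let `W` be a finite set of variables disjoint from the variables of `α`,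
`S` a finite set of atoms, each of the form `u ≤ u'` with `u, u' ∈ W`, or `c_i ≤ u`, or
`u ≤ c_i` with `u ∈ W`, and `S'` the result of replacing each constant `c_i` by the
variable `w_i`.  For every nontrivial assignment `f` of `{y_0,…,y_3}` the following are
equivalent: (i) some assignment of `{x_0,…,x_3,w_0,…,w_3} ∪ W` extending `f` satisfies
every atom of `α` and of `S'` in `B`; (ii) some `g : W → B` satisfies every atom of `S`
in `B` with each `c_i` interpreted as `i`. -/
theorem stmt_11 {W : Type*} [Fintype W]
    (S : Set ((W ⊕ Fin 4) × (W ⊕ Fin 4)))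
    (hS : ∀ a ∈ S, (∃ u : W, a.1 = Sum.inl u) ∨ (∃ u : W, a.2 = Sum.inl u))
    (f : Fin 4 → Fin 4) (hf : NontrivialAssign f) :
    (∃ (x w : Fin 4 → Fin 4) (h : W → Fin 4), AlphaSat x f w ∧
      ∀ a ∈ S, Ble (evalW h w a.1) (evalW h w a.2)) ↔
    (∃ g : W → Fin 4, ∀ a ∈ S, Ble (evalC g a.1) (evalC g a.2)) := by
  constructor
  · rintro ⟨x, w, h, hα, hsat⟩
    obtain rfl := hα.eq_of_nontrivialAssign hf
    have eval (t : W ⊕ Fin 4) : w (evalW h w t) = evalC (w ∘ h) t := by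
      cases t with
      | inl u => rfl
      | inr i => exact hf.involutive i
    refine ⟨w ∘ h, fun a ha => ?_⟩
    rw [← eval, ← eval]
    exact hf.map_ble (hsat a ha)
  · rintro ⟨g, hsat⟩
    have eval (t : W ⊕ Fin 4) : f (evalC g t) = evalW (f ∘ g) f t := by
      cases t <;> rfl
    refine ⟨f, f, f ∘ g, hf.alphaSat_s11, fun a ha => ?_⟩
    rw [← eval, ← eval]
    exact hf.map_ble (hsat a ha)
end

section
/- Let X be a finite set and let σ be a finite family of subsets of X such that ∅ ≠ U and U ≠ X for every U ∈ σ. Let d(X,σ) be the poset on the disjoint union of X and σ whose strict order consists exactly of the pairs h < U with h ∈ X, U ∈ σ, and h ∉ U. Then the minimal elements of d(X,σ) are exactly the elements of X, and for every k ≥ 1 the following are equivalent: (i) there exist h_1, …, h_k ∈ X, not all equal, such that every U ∈ σ contains some h_i; (ii) there exist minimal elements p_1, …, p_k of d(X,σ) that have no common upper bound in d(X,σ). -/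
/-- The order of the poset `d(X,σ)` on the disjoint union of `X` and `σ`: the strict order
consists exactly of the pairs `h < U` with `h ∈ X`, `U ∈ σ`, and `h ∉ U`. -/
def dle {X : Type*} {σ : Finset (Set X)}
    (a b : X ⊕ {U : Set X // U ∈ σ}) : Prop :=
  a = b ∨ ∃ (h : X) (U : {U : Set X // U ∈ σ}),
    a = Sum.inl h ∧ b = Sum.inr U ∧ h ∉ U.val

lemma dle_inl_right {X : Type*} {σ : Finset (Set X)} {q : X ⊕ {U : Set X // U ∈ σ}} {h : X} :
    dle q (Sum.inl h) ↔ q = Sum.inl h := by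
  simp [dle]

lemma dle_inl_inr {X : Type*} {σ : Finset (Set X)} {h : X} {U : {U : Set X // U ∈ σ}} :
    dle (Sum.inl h) (Sum.inr U) ↔ h ∉ U.val := by
  simp [dle]

lemma dle_minimal_iff {X : Type*} {σ : Finset (Set X)} (hσ : ∀ U ∈ σ, U ≠ Set.univ)
    (p : X ⊕ {U : Set X // U ∈ σ}) :
    (∀ q, dle q p → q = p) ↔ ∃ h : X, p = Sum.inl h := by
  constructor
  · intro hp
    rcases p with h | U
    · exact ⟨h, rfl⟩
    · obtain ⟨h, hh⟩ := (Set.ne_univ_iff_exists_notMem _).1 (hσ U.1 U.2)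
      exact ⟨h, (hp _ (dle_inl_inr.2 hh)).symm⟩
  · rintro ⟨h, rfl⟩ q hq
    exact dle_inl_right.1 hq

/-- Let `X` be a finite set and `σ` a finite family of subsets of `X` with
`∅ ≠ U` and `U ≠ X` for every `U ∈ σ`.  In the poset `d(X,σ)`, the minimal elements are
exactly the elements of `X`, and for every `k ≥ 1` the following are equivalent:
(i) there are `h_1, …, h_k ∈ X`, not all equal, such that every `U ∈ σ` contains some
`h_i`; (ii) there are minimal elements `p_1, …, p_k` of `d(X,σ)` with no common upper
bound in `d(X,σ)`. -/
theorem stmt_13 {X : Type*} [Fintype X] (σ : Finset (Set X))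
    (hσ : ∀ U ∈ σ, U.Nonempty ∧ U ≠ Set.univ) :
    (∀ p : X ⊕ {U : Set X // U ∈ σ},
      (∀ q, dle q p → q = p) ↔ ∃ h : X, p = Sum.inl h) ∧
    (∀ k : ℕ, 1 ≤ k →
      ((∃ h : Fin k → X, (∃ i j, h i ≠ h j) ∧ ∀ U ∈ σ, ∃ i, h i ∈ U) ↔
       (∃ p : Fin k → (X ⊕ {U : Set X // U ∈ σ}),
          (∀ i, ∀ q, dle q (p i) → q = p i) ∧
          ¬ ∃ u, ∀ i, dle (p i) u))) := by
  have hmin := dle_minimal_iff fun U hU => (hσ U hU).2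
  refine ⟨hmin, fun k hk => ⟨?_, ?_⟩⟩
  · rintro ⟨h, ⟨i, j, hij⟩, hU⟩
    refine ⟨fun i => Sum.inl (h i), fun i => (hmin _).2 ⟨h i, rfl⟩, ?_⟩
    rintro ⟨x | U, hu⟩
    · have heq : ∀ l, h l = x := fun l => Sum.inl_injective (dle_inl_right.1 (hu l))
      exact hij ((heq i).trans (heq j).symm)
    · obtain ⟨l, hl⟩ := hU U.1 U.2
      exact dle_inl_inr.1 (hu l) hl
  · rintro ⟨p, hp, hub⟩
    choose h hh using fun i => (hmin (p i)).1 (hp i)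
    obtain rfl : p = fun i => Sum.inl (h i) := funext hh
    refine ⟨h, ?_, fun U hU => ?_⟩
    · by_contra! heq
      exact hub ⟨Sum.inl (h ⟨0, hk⟩), fun i => dle_inl_right.2 (congrArg Sum.inl (heq i _))⟩
    · by_contra! hnot
      exact hub ⟨Sum.inr ⟨U, hU⟩, fun i => dle_inl_inr.2 (hnot i)⟩
end

section
/- Let P be a nonempty poset, let φ be a quantified conjunctive sentence in prefix form with variable sequence v_1, …, v_n and matrix M, and let Z be a subset of {v_1,…,v_n}. If φ is true in P, then the restricted sentence φ|_Z is true in P. -/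
/- A quantified conjunctive sentence in prefix form over `{≤}` is given by a linearly
ordered finite index type `ι` of variables (the prefix order), a labelling
`label : ι → Bool` (`false` = universal, `true` = existential), and its matrix
`M : Set (ι × ι)`, where `(u,v) ∈ M` stands for the atom `u ≤ v`. -/

/-- The full assignment induced by Skolem functions `g` (one for each existential variable,
depending on the values of the universal variables preceding it) and an assignment `f` of
the universal variables. -/
def inducedAssign {P ι : Type*} [LinearOrder ι] (label : ι → Bool)
    (g : (j : ι) → ({i : ι // label i = false ∧ i < j} → P) → P)
    (f : {i : ι // label i = false} → P) (i : ι) : P :=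
  if h : label i = false then f ⟨i, h⟩ else g i (fun k => f ⟨k.1, k.2.1⟩)

/-- Truth of the quantified conjunctive sentence `(label, M)` in the poset `P`: there are
Skolem functions for the existential variables such that for every assignment of the
universal variables, the induced full assignment satisfies every atom of the matrix. -/
def TruthQC (P : Type*) [PartialOrder P] {ι : Type*} [LinearOrder ι]
    (label : ι → Bool) (M : Set (ι × ι)) : Prop :=
  ∃ g : (j : ι) → ({i : ι // label i = false ∧ i < j} → P) → P,
    ∀ f : {i : ι // label i = false} → P,
      ∀ a ∈ M, inducedAssign label g f a.1 ≤ inducedAssign label g f a.2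

/-- Let `P` be a nonempty poset, `φ` a quantified conjunctive sentence in
prefix form with variable sequence `v_1, …, v_n` and matrix `M`, and `Z` a subset of the
variables.  If `φ` is true in `P`, then the restricted sentence `φ|_Z` (whose variable
sequence is the subsequence of variables in `Z`, with the same labels, and whose matrix is
`M ∩ (Z × Z)`) is true in `P`. -/
theorem stmt_14 {P : Type*} [PartialOrder P] [Nonempty P]
    (n : ℕ) (label : Fin n → Bool) (M : Set (Fin n × Fin n)) (Z : Set (Fin n))
    (hT : TruthQC P label M) :
    TruthQC P (fun i : {i : Fin n // i ∈ Z} => label i.1)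
      {a : {i : Fin n // i ∈ Z} × {i : Fin n // i ∈ Z} | (a.1.1, a.2.1) ∈ M} := by
  classical
  obtain ⟨g, hg⟩ := hT
  obtain ⟨p⟩ := ‹Nonempty P›
  refine ⟨fun j x => g j.1 fun k =>
    if h : k.1 ∈ Z then x ⟨⟨k.1, h⟩, k.2.1, k.2.2⟩ else p, fun f a ha => ?_⟩
  have key := hg (fun k => if h : k.1 ∈ Z then f ⟨⟨k.1, h⟩, k.2⟩ else p) (a.1.1, a.2.1) ha
  simpa only [inducedAssign, Subtype.coe_prop, dite_true] using key
end
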